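/- arXiv:2302.12872 — 4 statements merged into one kernel-verified Lean document; each statement's English description precedes it below -/
import Mathlib

section
/- Let 0 < θ̄_Δ ≤ π/2, let T ≥ 2, and let −θ̄_Δ ≤ θ̂₁ < θ̂₂ < … < θ̂_T ≤ θ̄_Δ. For adjacent indices t define θ̃_{t,t+1} = (θ̂_t·sin(θ̂_t) − θ̂_{t+1}·sin(θ̂_{t+1}) + cos(θ̂_t) − cos(θ̂_{t+1})) / (sin(θ̂_t) − sin(θ̂_{t+1})), and define the relaxation error e(θ) = min_{t=1,…,T} B₁(θ; θ̂_t) − cos(θ). Then the maximum of e over [−θ̄_Δ, θ̄_Δ] is attained at a point of the finite set {θ̃_{t,t+1} : t = 1,…,T−1} ∪ {−θ̄_Δ, θ̄_Δ}. -/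
open Real

/-- The line tangent to `cos` at `θhat`, evaluated at `θ`. -/
noncomputable def B₁ (θ θhat : ℝ) : ℝ := (θhat - θ) * Real.sin θhat + Real.cos θhat

/-- The abscissa at which the tangent lines to `cos` at `a` and `b` intersect. -/
noncomputable def tildePt (a b : ℝ) : ℝ :=
  (a * Real.sin a - b * Real.sin b + Real.cos a - Real.cos b) /
    (Real.sin a - Real.sin b)

lemma cos_le_B₁ {a x : ℝ} (ha : a ∈ Set.Icc (-(π / 2)) (π / 2))
    (hx : x ∈ Set.Icc (-(π / 2)) (π / 2)) : Real.cos x ≤ B₁ x a := by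
  have hd : HasDerivAt Real.cos (-Real.sin a) a := Real.hasDerivAt_cos a
  have hcos := strictConcaveOn_cos_Icc.concaveOn
  unfold B₁
  rcases lt_trichotomy a x with h | rfl | h
  · have := hcos.slope_le_of_hasDerivAt ha hx h hd
    rw [slope_def_field, div_le_iff₀ (by linarith)] at this
    linarith
  · simp
  · have := hcos.le_slope_of_hasDerivAt hx ha h hd
    rw [slope_def_field, le_div_iff₀ (by linarith)] at this
    linarith

lemma B₁_self (a : ℝ) : B₁ a a = Real.cos a := by simp [B₁]

lemma B₁_sub_B₁ {a b : ℝ} (h : Real.sin a < Real.sin b) (x : ℝ) :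
    B₁ x a - B₁ x b = (x - tildePt a b) * (Real.sin b - Real.sin a) := by
  have : Real.sin a - Real.sin b ≠ 0 := by linarith
  unfold B₁ tildePt
  field_simp
  ring

lemma B₁_le_B₁_iff {a b : ℝ} (h : Real.sin a < Real.sin b) (x : ℝ) :
    B₁ x b ≤ B₁ x a ↔ tildePt a b ≤ x := by
  rw [← sub_nonneg, B₁_sub_B₁ h, mul_nonneg_iff_of_pos_right (sub_pos.2 h), sub_nonneg]

lemma B₁_le_B₁_iff' {a b : ℝ} (h : Real.sin a < Real.sin b) (x : ℝ) :
    B₁ x a ≤ B₁ x b ↔ x ≤ tildePt a b := by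
  rw [← sub_nonneg, ← neg_sub, B₁_sub_B₁ h, ← neg_mul, neg_sub,
    mul_nonneg_iff_of_pos_right (sub_pos.2 h), sub_nonneg]

lemma tildePt_mem_Icc {a b : ℝ} (hab : a < b) (ha : a ∈ Set.Icc (-(π / 2)) (π / 2))
    (hb : b ∈ Set.Icc (-(π / 2)) (π / 2)) : tildePt a b ∈ Set.Icc a b := by
  have h := Real.strictMonoOn_sin ha hb hab
  refine ⟨(B₁_le_B₁_iff' h a).1 ?_, (B₁_le_B₁_iff h b).1 ?_⟩
  · rw [B₁_self]; exact cos_le_B₁ hb ha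
  · rw [B₁_self]; exact cos_le_B₁ ha hb

lemma convexOn_B₁_sub_cos (a : ℝ) :
    ConvexOn ℝ (Set.Icc (-(π / 2)) (π / 2)) (fun x => B₁ x a - Real.cos x) := by
  refine ConvexOn.sub ⟨convex_Icc _ _, ?_⟩ strictConcaveOn_cos_Icc.concaveOn
  intro x _ y _ p q _ _ hpq
  obtain rfl : p = 1 - q := by linarith
  apply le_of_eq
  simp only [B₁, smul_eq_mul]
  ring

/-- To the right of an intersection point with the preceding tangent line, a tangent line lies
below all the preceding ones; to the left of an intersection point with the following tangent line,
it lies below all the following ones. -/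
lemma B₁_le_B₁_of_tildePt {n : ℕ} {u : Fin n → ℝ} (hu : StrictMono u)
    (hmem : ∀ s, u s ∈ Set.Icc (-(π / 2)) (π / 2)) {i j : Fin n} (hij : (i : ℕ) + 1 = j) {x : ℝ} :
    (tildePt (u i) (u j) ≤ x → ∀ t < j, B₁ x (u j) ≤ B₁ x (u t)) ∧
    (x ≤ tildePt (u i) (u j) → ∀ t > i, B₁ x (u i) ≤ B₁ x (u t)) := by
  have hsin {s t : Fin n} (h : s < t) : Real.sin (u s) < Real.sin (u t) :=
    Real.strictMonoOn_sin (hmem s) (hmem t) (hu h)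
  have hlt : i < j := by rw [Fin.lt_def]; omega
  have htilde := tildePt_mem_Icc (hu hlt) (hmem i) (hmem j)
  constructor
  · intro hx t ht
    have h₁ := (B₁_le_B₁_iff (hsin hlt) x).2 hx
    rcases eq_or_lt_of_le (show t ≤ i by rw [Fin.le_def]; rw [Fin.lt_def] at ht; omega)
      with rfl | hti
    · exact h₁
    · have := tildePt_mem_Icc (hu hti) (hmem t) (hmem i)
      exact h₁.trans ((B₁_le_B₁_iff (hsin hti) x).2 (by linarith [this.2, htilde.1]))
  · intro hx t ht
    have h₁ := (B₁_le_B₁_iff' (hsin hlt) x).2 hx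
    rcases eq_or_lt_of_le (show j ≤ t by rw [Fin.le_def]; rw [gt_iff_lt, Fin.lt_def] at ht; omega)
      with rfl | htj
    · exact h₁
    · have := tildePt_mem_Icc (hu htj) (hmem j) (hmem t)
      exact h₁.trans ((B₁_le_B₁_iff' (hsin htj) x).2 (by linarith [this.1, htilde.2]))

theorem max_relaxation_error_attained_at_breakpoints
    (c : ℝ) (hc0 : 0 < c) (hc : c ≤ π / 2)
    (T : ℕ) (hT : 2 ≤ T) (θhat : Fin T → ℝ) (hmono : StrictMono θhat)
    (hlo : -c ≤ θhat ⟨0, by omega⟩) (hhi : θhat ⟨T - 1, by omega⟩ ≤ c) :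
    ∃ θstar ∈ Set.Icc (-c) c,
      (θstar = -c ∨ θstar = c ∨
        ∃ t : Fin T, ∃ ht : (t : ℕ) + 1 < T,
          θstar = tildePt (θhat t) (θhat ⟨(t : ℕ) + 1, ht⟩)) ∧
      ∀ θ ∈ Set.Icc (-c) c,
        (⨅ s : Fin T, B₁ θ (θhat s)) - Real.cos θ ≤
          (⨅ s : Fin T, B₁ θstar (θhat s)) - Real.cos θstar := by
  have hmem' : ∀ s, θhat s ∈ Set.Icc (-c) c := fun s =>
    ⟨hlo.trans (hmono.monotone (by simp [Fin.le_def])),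
      (hmono.monotone (by rw [Fin.le_def]; simp only; omega)).trans hhi⟩
  have hsub : Set.Icc (-c) c ⊆ Set.Icc (-(π / 2)) (π / 2) :=
    Set.Icc_subset_Icc (by linarith) hc
  have hmem : ∀ s, θhat s ∈ Set.Icc (-(π / 2)) (π / 2) := fun s => hsub (hmem' s)
  have hsin {s t : Fin T} (h : s < t) : Real.sin (θhat s) < Real.sin (θhat t) :=
    Real.strictMonoOn_sin (hmem s) (hmem t) (hmono h)
  have : Nonempty (Fin T) := ⟨⟨0, by omega⟩⟩
  have hbdd (x : ℝ) : BddBelow (Set.range fun s : Fin T => B₁ x (θhat s)) :=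
    (Set.finite_range _).bddBelow
  let S : Set ℝ := {x | x ∈ Set.Icc (-c) c ∧ (x = -c ∨ x = c ∨
    ∃ t : Fin T, ∃ ht : (t : ℕ) + 1 < T, x = tildePt (θhat t) (θhat ⟨(t : ℕ) + 1, ht⟩))}
  have hS : S.Finite := by
    refine ((Set.toFinite {-c, c}).union (Set.finite_range
      fun p : Fin T × Fin T => tildePt (θhat p.1) (θhat p.2))).subset ?_
    rintro x ⟨-, rfl | rfl | ⟨t, ht, rfl⟩⟩
    · simp
    · simp
    · exact Or.inr ⟨(t, ⟨t + 1, ht⟩), rfl⟩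
  have htS (t : Fin T) (ht : (t : ℕ) + 1 < T) :
      tildePt (θhat t) (θhat ⟨(t : ℕ) + 1, ht⟩) ∈ S := by
    have := tildePt_mem_Icc (hmono (show t < ⟨(t : ℕ) + 1, ht⟩ by simp [Fin.lt_def]))
      (hmem _) (hmem _)
    exact ⟨⟨(hmem' _).1.trans this.1, this.2.trans (hmem' _).2⟩, Or.inr (Or.inr ⟨t, ht, rfl⟩)⟩
  obtain ⟨p, hp, hmax⟩ := hS.exists_maximalFor
    (fun x => (⨅ s : Fin T, B₁ x (θhat s)) - Real.cos x) S
    ⟨c, ⟨by linarith, le_rfl⟩, Or.inr (Or.inl rfl)⟩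
  refine ⟨p, hp.1, hp.2, fun θ hθ => ?_⟩
  obtain ⟨s, hs⟩ := exists_eq_ciInf_of_finite (f := fun s : Fin T => B₁ θ (θhat s))
  have hmin (t : Fin T) : B₁ θ (θhat s) ≤ B₁ θ (θhat t) := hs ▸ ciInf_le (hbdd θ) t
  -- the endpoints of the interval on which the tangent line at `θhat s` is the lowest one
  obtain ⟨l, hlS, hlθ, hl⟩ : ∃ l ∈ S, l ≤ θ ∧
      ∀ x, l ≤ x → ∀ t < s, B₁ x (θhat s) ≤ B₁ x (θhat t) := by
    rcases Nat.eq_zero_or_pos (s : ℕ) with h0 | h0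
    · exact ⟨-c, ⟨⟨le_rfl, by linarith⟩, Or.inl rfl⟩, hθ.1, fun _ _ t ht => by
        rw [Fin.lt_def] at ht; omega⟩
    · obtain ⟨i, hi⟩ : ∃ i : Fin T, (i : ℕ) + 1 = s := ⟨⟨s - 1, by omega⟩, by simp only; omega⟩
      have heq : (⟨(i : ℕ) + 1, hi ▸ s.2⟩ : Fin T) = s := Fin.ext hi
      have hiS := htS i (hi ▸ s.2)
      rw [heq] at hiS
      exact ⟨_, hiS, (B₁_le_B₁_iff (hsin (by rw [Fin.lt_def]; omega)) θ).1 (hmin i),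
        fun x hx => (B₁_le_B₁_of_tildePt hmono hmem hi).1 hx⟩
  obtain ⟨r, hrS, hθr, hr⟩ : ∃ r ∈ S, θ ≤ r ∧
      ∀ x, x ≤ r → ∀ t > s, B₁ x (θhat s) ≤ B₁ x (θhat t) := by
    by_cases hsT : (s : ℕ) + 1 < T
    · exact ⟨_, htS s hsT, (B₁_le_B₁_iff' (hsin (by simp [Fin.lt_def])) θ).1 (hmin _),
        fun x hx => (B₁_le_B₁_of_tildePt hmono hmem rfl).2 hx⟩
    · exact ⟨c, ⟨⟨by linarith, le_rfl⟩, Or.inr (Or.inl rfl)⟩, hθ.2, fun _ _ t ht => by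
        rw [gt_iff_lt, Fin.lt_def] at ht; omega⟩
  have hle {x : ℝ} (hxS : x ∈ S) (hlx : l ≤ x) (hxr : x ≤ r) :
      B₁ x (θhat s) - Real.cos x ≤ (⨅ s : Fin T, B₁ p (θhat s)) - Real.cos p := by
    refine le_trans (sub_le_sub_right (le_ciInf fun t => ?_) _)
      ((le_total _ _).elim id (hmax hxS))
    rcases lt_trichotomy t s with h | rfl | h
    · exact hl x hlx t h
    · exact le_rfl
    · exact hr x hxr t h
  rw [← hs]
  exact ((convexOn_B₁_sub_cos (θhat s)).le_max_of_mem_Icc (hsub hlS.1) (hsub hrS.1)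
    ⟨hlθ, hθr⟩).trans (max_le (hle hlS le_rfl (hlθ.trans hθr)) (hle hrS (hlθ.trans hθr) le_rfl))
end

section
/- The function u ↦ cos(√u) is convex on the interval [0, π²]. -/
open Real

/-- `x ↦ sin x / x` is antitone on `(0, π]`. -/
theorem antitoneOn_sin_div : AntitoneOn (fun x : ℝ => sin x / x) (Set.Ioc 0 π) := by
  rintro x ⟨hx, -⟩ y ⟨hy, hyπ⟩ hxy
  have h := strictConcaveOn_sin_Icc.concaveOn.2 ⟨hy.le, hyπ⟩ ⟨le_rfl, pi_pos.le⟩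
    (div_nonneg hx.le hy.le) (sub_nonneg.2 ((div_le_one hy).2 hxy)) (add_sub_cancel _ _)
  simp only [smul_eq_mul, sin_zero, mul_zero, add_zero, div_mul_cancel₀ x hy.ne'] at h
  rw [div_mul_eq_mul_div, div_le_iff₀ hy] at h
  change sin y / y ≤ sin x / x
  rw [div_le_div_iff₀ hy hx]
  linarith

theorem hasDerivAt_cos_sqrt {u : ℝ} (hu : 0 < u) :
    HasDerivAt (fun u : ℝ => cos (√u)) (-(sin (√u) / √u) / 2) u := by
  refine (hasDerivAt_sqrt hu.ne').cos.congr_deriv ?_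
  have := (sqrt_pos.2 hu).ne'
  field_simp

theorem cos_sqrt_convex :
    ConvexOn ℝ (Set.Icc (0 : ℝ) (π ^ 2)) (fun u : ℝ => Real.cos (Real.sqrt u)) := by
  refine MonotoneOn.convexOn_of_deriv (convex_Icc _ _) (by fun_prop) ?_ ?_ <;>
    rw [interior_Icc]
  · exact fun u hu => (hasDerivAt_cos_sqrt hu.1).differentiableAt.differentiableWithinAt
  · intro u hu v hv huv
    rw [(hasDerivAt_cos_sqrt hu.1).deriv, (hasDerivAt_cos_sqrt hv.1).deriv]
    have mem : ∀ w ∈ Set.Ioo (0 : ℝ) (π ^ 2), √w ∈ Set.Ioc 0 π := fun w hw =>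
      ⟨sqrt_pos.2 hw.1, (sqrt_le_left pi_pos.le).2 hw.2.le⟩
    have h : sin (√v) / √v ≤ sin (√u) / √u :=
      antitoneOn_sin_div (mem u hu) (mem v hv) (sqrt_le_sqrt huv)
    linarith
end

section
/- Let 0 < c ≤ π. Then for every θ with |θ| ≤ c, cos(θ) ≤ 1 − (1 − cos(c))·(θ/c)². -/
open Real

/-- Concavity of the sine on `[0, π]`, on the segment from `0` to `x`. -/
theorem mul_sin_le_sin_mul {t x : ℝ} (ht0 : 0 ≤ t) (ht1 : t ≤ 1) (hx0 : 0 ≤ x) (hx : x ≤ π) :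
    t * sin x ≤ sin (t * x) := by
  simpa using strictConcaveOn_sin_Icc.concaveOn.2 ⟨le_rfl, pi_pos.le⟩ ⟨hx0, hx⟩
    (sub_nonneg.2 ht1) ht0 (sub_add_cancel 1 t)

theorem cos_eq_one_sub_two_mul_sin_half_sq (x : ℝ) : cos x = 1 - 2 * sin (x / 2) ^ 2 := by
  have h := cos_two_mul (x / 2)
  rw [mul_div_cancel₀ x two_ne_zero, cos_sq'] at h
  linarith

theorem quadratic_cosine_bound
    (c : ℝ) (hc0 : 0 < c) (hc : c ≤ π) (θ : ℝ) (hθ : |θ| ≤ c) :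
    Real.cos θ ≤ 1 - (1 - Real.cos c) * (θ / c) ^ 2 := by
  have hsin : 0 ≤ sin (c / 2) := sin_nonneg_of_nonneg_of_le_pi (by linarith) (by linarith)
  have ht0 : 0 ≤ |θ| / c := by positivity
  have key : |θ| / c * sin (c / 2) ≤ sin (|θ| / 2) := by
    have h := mul_sin_le_sin_mul ht0 ((div_le_one hc0).2 hθ) (x := c / 2)
      (by linarith) (by linarith)
    rwa [show |θ| / c * (c / 2) = |θ| / 2 by field_simp] at h
  have hsq := pow_le_pow_left₀ (mul_nonneg ht0 hsin) key 2
  rw [mul_pow, div_pow, sq_abs, ← div_pow] at hsq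
  rw [← cos_abs θ, cos_eq_one_sub_two_mul_sin_half_sq |θ|, cos_eq_one_sub_two_mul_sin_half_sq c]
  linarith
end

section
/- Let 0 < c ≤ π and |θ| ≤ c. Then cos(θ) = 1 − (1 − cos(c))·(θ/c)² if and only if θ ∈ {−c, 0, c}. -/
open Real

theorem div_mul_sin_lt_sin {x y : ℝ} (hx : 0 < x) (hxy : x < y) (hy : y ≤ π) :
    x / y * sin y < sin x := by
  have hy0 : 0 < y := hx.trans hxy
  have h := strictConcaveOn_sin_Icc.2 (x := y) (y := 0) ⟨hy0.le, hy⟩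
    ⟨le_rfl, pi_pos.le⟩ hy0.ne' (div_pos hx hy0)
    (sub_pos.2 ((div_lt_one hy0).2 hxy)) (add_sub_cancel _ _)
  simpa [div_mul_cancel₀ x hy0.ne'] using h

theorem one_sub_cos_eq_two_mul_sin_half_sq (x : ℝ) : 1 - cos x = 2 * sin (x / 2) ^ 2 := by
  have h := cos_sq' (x / 2)
  rw [cos_sq, mul_div_cancel₀ x two_ne_zero] at h
  linarith

theorem cos_lt_one_sub_mul_div_sq {c θ : ℝ} (hc : c ≤ π) (hθ0 : 0 < θ) (hθ : θ < c) :
    cos θ < 1 - (1 - cos c) * (θ / c) ^ 2 := by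
  have h := div_mul_sin_lt_sin (half_pos hθ0) (div_lt_div_of_pos_right hθ two_pos)
    (by linarith [pi_pos])
  rw [div_div_div_cancel_right₀ two_ne_zero] at h
  have hs : 0 ≤ sin (c / 2) :=
    sin_nonneg_of_nonneg_of_le_pi (by linarith) (by linarith [pi_pos])
  have hq : 0 ≤ θ / c := div_nonneg hθ0.le (hθ0.trans hθ).le
  have hsq := pow_lt_pow_left₀ h (mul_nonneg hq hs) two_ne_zero
  have hcos := one_sub_cos_eq_two_mul_sin_half_sq θ
  rw [one_sub_cos_eq_two_mul_sin_half_sq c]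
  rw [mul_pow] at hsq
  linarith

theorem quadratic_cosine_bound_equality_iff
    (c : ℝ) (hc0 : 0 < c) (hc : c ≤ π) (θ : ℝ) (hθ : |θ| ≤ c) :
    Real.cos θ = 1 - (1 - Real.cos c) * (θ / c) ^ 2 ↔ θ = -c ∨ θ = 0 ∨ θ = c := by
  constructor
  · intro h
    by_contra! hne
    have habs : |θ| ≠ c := fun he ↦ by
      rcases eq_or_eq_neg_of_abs_eq he with h' | h'
      · exact hne.2.2 h'
      · exact hne.1 h'
    have hlt := cos_lt_one_sub_mul_div_sq hc (abs_pos.2 hne.2.1) (lt_of_le_of_ne hθ habs)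
    rw [cos_abs, div_pow, sq_abs, ← div_pow] at hlt
    exact hlt.ne h
  · rintro (rfl | rfl | rfl)
    · simp [neg_div, div_self hc0.ne']
    · simp
    · simp [div_self hc0.ne']
end
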